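/- For every integer n ≥ 10, the online size Ramsey number satisfies r̃(P_4, P_n) = ⌈7n/5⌉ − 1. -/

import Mathlib

namespace OSR

/-- A partial red/blue colouring of the edges of the complete graph on `ℕ`:
`some true` = red, `some false` = blue, `none` = unselected. -/
abbrev Coloring := Sym2 ℕ → Option Bool

/-- The colouring `C` contains a monochromatic path of colour `c` on `k` vertices. -/
def HasPath (C : Coloring) (c : Bool) (k : ℕ) : Prop :=
  ∃ f : Fin k → ℕ, Function.Injective f ∧
    ∀ i j : Fin k, (j : ℕ) = (i : ℕ) + 1 → C s(f i, f j) = some c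

/-- A Builder strategy: given the current position, select an edge. -/
abbrev BuilderStrat := Coloring → Sym2 ℕ

/-- A Painter strategy: given the current position and the selected edge,
choose a colour (`true` = red, `false` = blue). -/
abbrev PainterStrat := Coloring → Sym2 ℕ → Bool

/-- The position after `t` rounds of play, starting from `C0`. -/
def play (C0 : Coloring) (B : BuilderStrat) (P : PainterStrat) : ℕ → Coloring
  | 0 => C0
  | t + 1 =>
    Function.update (play C0 B P t) (B (play C0 B P t))
      (some (P (play C0 B P t) (B (play C0 B P t))))

/-- Builder plays legally: he always selects a previously unselected non-loop edge. -/
def BuilderOK (C0 : Coloring) (B : BuilderStrat) : Prop :=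
  ∀ (P : PainterStrat) (t : ℕ),
    play C0 B P t (B (play C0 B P t)) = none ∧ ¬(B (play C0 B P t)).IsDiag

/-- The empty position: no edge has been coloured. -/
def emptyCol : Coloring := fun _ => none

/-- The online Ramsey game for `(P_k, P_n)` has ended: there is a red path on `k`
vertices or a blue path on `n` vertices. -/
def Ends (k n : ℕ) (C : Coloring) : Prop := HasPath C true k ∨ HasPath C false n

/-- The online size Ramsey number `r̃(P_k, P_n)`: the least `t` such that Builder
has a strategy forcing, against every Painter, a red `P_k` or a blue `P_n`
within at most `t` rounds. -/
noncomputable def onlineRamseyPath (k n : ℕ) : ℕ :=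
  sInf {t : ℕ | ∃ B : BuilderStrat, BuilderOK emptyCol B ∧
    ∀ P : PainterStrat, ∃ s ≤ t, Ends k n (play emptyCol B P s)}

/-- Painter plays legally in the game `RR_H(P_k, ⬝)`: he never colours an edge red
if that would create a red path on `k` vertices. -/
def PainterOK (k : ℕ) (P : PainterStrat) : Prop :=
  ∀ (C : Coloring) (e : Sym2 ℕ),
    ¬HasPath C true k → HasPath (Function.update C e (some true)) true k →
      P C e = false

/-- The colour `c` is an allowed answer of Painter on the edge `e` in position `C`
of the game `RR(P_k, ⬝)`. -/
def Allowed (k : ℕ) (C : Coloring) (e : Sym2 ℕ) (c : Bool) : Prop :=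
  c = true → ¬HasPath C true k → ¬HasPath (Function.update C e (some true)) true k

/-- One round in the variant where Builder may reselect an already coloured edge,
in which case it keeps its colour. -/
def stepR (C : Coloring) (e : Sym2 ℕ) (c : Bool) : Coloring :=
  if C e = none then Function.update C e (some c) else C

/-- The position after `t` rounds, in the variant where a reselected edge keeps
its colour (and the round still counts). -/
def playR (C0 : Coloring) (B : BuilderStrat) (P : PainterStrat) : ℕ → Coloring
  | 0 => C0
  | t + 1 =>
    stepR (playR C0 B P t) (B (playR C0 B P t))
      (P (playR C0 B P t) (B (playR C0 B P t)))

/-- Builder plays legally in the reselection variant: he selects non-loop edges. -/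
def BuilderOKR (C0 : Coloring) (B : BuilderStrat) : Prop :=
  ∀ (P : PainterStrat) (t : ℕ), ¬(B (playR C0 B P t)).IsDiag

/-- Consecutive members of `l` are joined by blue edges. -/
def BlueChain (C : Coloring) (l : List ℕ) : Prop :=
  l.Chain' fun a b => C s(a, b) = some false

/-- Consecutive members of `l` are joined by red edges. -/
def RedChain (C : Coloring) (l : List ℕ) : Prop :=
  l.Chain' fun a b => C s(a, b) = some true

/-- `l` is the vertex sequence of a blue path (on at least one vertex) in `C`. -/
def IsBluePath (C : Coloring) (l : List ℕ) : Prop :=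
  l ≠ [] ∧ l.Nodup ∧ BlueChain C l

/-- `l` is the vertex sequence of a red path (on at least one vertex) in `C`. -/
def IsRedPath (C : Coloring) (l : List ℕ) : Prop :=
  l ≠ [] ∧ l.Nodup ∧ RedChain C l

/-- `x` is an end of the path with vertex sequence `l`. -/
def IsEnd (x : ℕ) (l : List ℕ) : Prop :=
  l.head? = some x ∨ l.getLast? = some x

/-- `e` joins two consecutive vertices of `l`, i.e. `e` is an edge of the path `l`. -/
def IsPathEdge (l : List ℕ) (e : Sym2 ℕ) : Prop :=
  ∃ (i : ℕ) (h : i + 1 < l.length),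
    e = s(l.get ⟨i, Nat.lt_of_succ_lt h⟩, l.get ⟨i + 1, h⟩)

/-- The paths of the family `G` are pairwise vertex-disjoint. -/
def DisjFam {s : ℕ} (G : Fin s → List ℕ) : Prop :=
  ∀ i j, i ≠ j → ∀ x, x ∈ G i → x ∉ G j

/-- `C` contains `T` pairwise vertex-disjoint blue paths of length 2
(i.e. on 3 vertices each). -/
def HasDisjointBluePaths3 (C : Coloring) (T : ℕ) : Prop :=
  ∃ G : Fin T → List ℕ,
    (∀ i, (G i).length = 3 ∧ IsBluePath C (G i)) ∧ DisjFam G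

/-- `(G, u)` witnesses that `C` contains an essential `(s,d,m)`-graph:
`G` lists the `s` pairwise disjoint nonempty essential blue paths,
`u` lists the vertices of the essential red path, `u i` being an end of `G i`,
and the blue paths have `m` vertices in total. -/
def IsEssWitness (C : Coloring) (s d m : ℕ)
    (G : Fin s → List ℕ) (u : Fin d → ℕ) : Prop :=
  (∀ i, IsBluePath C (G i)) ∧ DisjFam G ∧
  Function.Injective u ∧
  (∀ i j : Fin d, (j : ℕ) = (i : ℕ) + 1 → C s(u i, u j) = some true) ∧
  (∀ (i : Fin d) (h : (i : ℕ) < s), IsEnd (u i) (G ⟨i, h⟩)) ∧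
  (∑ i, (G i).length) = m

/-- `C` contains an essential `(s,d,m)`-graph. -/
def IsEssGraph (C : Coloring) (s d m : ℕ) : Prop :=
  d ≤ s ∧ ∃ (G : Fin s → List ℕ) (u : Fin d → ℕ), IsEssWitness C s d m G u

/-- `C` contains an `(s,d,m)`-fence: a red picket `R` on `d` vertices whose last
vertex is the first vertex of the blue picket `G 0`, further pairwise disjoint
nonempty blue pickets `G 1, …`, the blue pickets having `m` vertices in total. -/
def IsFence (C : Coloring) (s d m : ℕ) : Prop :=
  ∃ (hs : 0 < s) (R : List ℕ) (G : Fin s → List ℕ),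
    R.length = d ∧ IsRedPath C R ∧
    (∀ i, IsBluePath C (G i)) ∧ DisjFam G ∧
    R.getLast? = (G ⟨0, hs⟩).head? ∧
    (∀ x ∈ R.dropLast, ∀ i, x ∉ G i) ∧
    (∑ i, (G i).length) = m

/-- There is a red path of length `len` (i.e. on `len + 1` vertices) with end `x`. -/
def RedTailAt (C : Coloring) (x : ℕ) (len : ℕ) : Prop :=
  ∃ l : List ℕ, l.length = len + 1 ∧ l.head? = some x ∧ IsRedPath C l

/-- `l` is a blue `(1,1)`-path: a blue path such that each of its two ends is an
end of a red path of length 1. -/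
def IsBlue11Path (C : Coloring) (l : List ℕ) : Prop :=
  IsBluePath C l ∧
  (∀ x, l.head? = some x → RedTailAt C x 1) ∧
  (∀ x, l.getLast? = some x → RedTailAt C x 1)

/-- `l = [u_1, …, u_k, u_{k+1}]` is an extended `(2,0)`-path: `k ≥ 2`, the edge
`u_k u_{k+1}` is red and `u_1 … u_k` is a blue `(2,0)`-path with `2`-end `u_k`
(its blue end is `u_1`, its transition vertex `u_k`, its red end `u_{k+1}`). -/
def IsExtPath (C : Coloring) (l : List ℕ) : Prop :=
  3 ≤ l.length ∧ l.Nodup ∧ BlueChain C l.dropLast ∧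
  ∀ a b, l.dropLast.getLast? = some a → l.getLast? = some b →
    C s(a, b) = some true ∧ RedTailAt C a 2

/-- The vertices `x 0, …, x 4` form a limb in `C`: blue edges `x0x1`, `x2x3`,
`x1x4` and a red edge `x1x2` (paper notation: blue `x1x2, x3x4, x2x5`, red `x2x3`). -/
def IsLimb (C : Coloring) (x : Fin 5 → ℕ) : Prop :=
  Function.Injective x ∧
  C s(x 0, x 1) = some false ∧ C s(x 2, x 3) = some false ∧
  C s(x 1, x 4) = some false ∧ C s(x 1, x 2) = some true

/-- The four edges of the limb on `x 0, …, x 4`. -/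
def limbEdgeSet (x : Fin 5 → ℕ) : Set (Sym2 ℕ) :=
  {s(x 0, x 1), s(x 2, x 3), s(x 1, x 4), s(x 1, x 2)}

/-- The limb on `x 0, …, x 4` is a component of `C`: every edge of `C` meeting
a limb vertex is an edge of the limb. -/
def LimbComponent (C : Coloring) (x : Fin 5 → ℕ) : Prop :=
  ∀ e, C e ≠ none → (∃ v ∈ e, v ∈ Set.range x) → e ∈ limbEdgeSet x

/-- The red edges of `C` with at least one end in `S`. -/
def RedAt (C : Coloring) (S : Set ℕ) : Set (Sym2 ℕ) :=
  {e | C e = some true ∧ ∃ v ∈ e, v ∈ S}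

/-- The blue edges of `C` with at least one end in `S`. -/
def BlueAt (C : Coloring) (S : Set ℕ) : Set (Sym2 ℕ) :=
  {e | C e = some false ∧ ∃ v ∈ e, v ∈ S}

def redEdges (C : Coloring) : Set (Sym2 ℕ) := {e | C e = some true}

def blueEdges (C : Coloring) : Set (Sym2 ℕ) := {e | C e = some false}

def allEdges (C : Coloring) : Set (Sym2 ℕ) := {e | C e ≠ none}

/-- The vertices of the coloured graph `C` (ends of coloured edges). -/
def supp (C : Coloring) : Set ℕ := {v | ∃ e, C e ≠ none ∧ v ∈ e}

/-- `a` and `b` are adjacent in `C`. -/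
def Adj (C : Coloring) (a b : ℕ) : Prop := a ≠ b ∧ C s(a, b) ≠ none

/-- `G_0 ∪ Red_H(G_0)` is a component of the coloured graph: every blue edge
meeting the blue path `l` is an edge of `l`, and the other end `y` of any red
edge leaving `l` meets only red edges coming back to `l`. -/
def G0Component (C : Coloring) (l : List ℕ) : Prop :=
  (∀ e, C e = some false → (∃ v ∈ e, v ∈ l) → IsPathEdge l e) ∧
  (∀ x ∈ l, ∀ y : ℕ, C s(x, y) = some true → y ∉ l →
    ∀ e, C e ≠ none → y ∈ e → C e = some true ∧ ∃ v ∈ e, v ∈ l)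

/-- The underlying list of an optional path (`∅` has no vertices). -/
def listOf (o : Option (List ℕ)) : List ℕ := o.getD []

/-- The vertex set of an optional limb. -/
def limbVertsOf : Option (Fin 5 → ℕ) → Set ℕ
  | none => ∅
  | some x => Set.range x

/-- The data of the four (possibly empty) essential subgraphs `(G_0, G_1, G_2, L)`
of a good graph: `G0` is a blue path, `G1` a blue `(1,1)`-path, `G2` an extended
`(2,0)`-path (each given by its vertex sequence), and `L` a limb. -/
structure GoodData where
  G0 : Option (List ℕ)
  G1 : Option (List ℕ)
  G2 : Option (List ℕ)
  L : Option (Fin 5 → ℕ)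

def GoodData.vG0 (D : GoodData) : ℕ := (listOf D.G0).length
def GoodData.vG1 (D : GoodData) : ℕ := (listOf D.G1).length
def GoodData.vG2 (D : GoodData) : ℕ := (listOf D.G2).length
def GoodData.vL (D : GoodData) : ℕ := match D.L with | none => 0 | some _ => 5

/-- The number of essential vertices. -/
def GoodData.ess (D : GoodData) : ℕ := D.vG0 + D.vG1 + D.vG2 + D.vL

/-- The set of essential vertices. -/
def GoodData.verts (D : GoodData) : Set ℕ :=
  {v | v ∈ listOf D.G0} ∪ {v | v ∈ listOf D.G1} ∪ {v | v ∈ listOf D.G2} ∪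
    limbVertsOf D.L

/-- The essential subgraphs are pairwise vertex-disjoint. -/
def GoodData.PartsDisjoint (D : GoodData) : Prop :=
  (∀ x ∈ listOf D.G0, x ∉ listOf D.G1) ∧
  (∀ x ∈ listOf D.G0, x ∉ listOf D.G2) ∧
  (∀ x ∈ listOf D.G0, x ∉ limbVertsOf D.L) ∧
  (∀ x ∈ listOf D.G1, x ∉ listOf D.G2) ∧
  (∀ x ∈ listOf D.G1, x ∉ limbVertsOf D.L) ∧
  (∀ x ∈ listOf D.G2, x ∉ limbVertsOf D.L)

/-- At least three of the four essential subgraphs are empty. -/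
def GoodData.Simple (D : GoodData) : Prop :=
  (D.G0 = none ∧ D.G1 = none ∧ D.G2 = none) ∨
  (D.G0 = none ∧ D.G1 = none ∧ D.L = none) ∨
  (D.G0 = none ∧ D.G2 = none ∧ D.L = none) ∨
  (D.G1 = none ∧ D.G2 = none ∧ D.L = none)

/-- `C` is a good graph with essential subgraphs `D = (G_0, G_1, G_2, L)`:
conditions (A)–(F) of the paper, where `⌈2x/5⌉ = (2x+4)/5` in `ℕ`. -/
def IsGood (C : Coloring) (D : GoodData) : Prop :=
  -- `C` is a (finite) coloured graph
  (allEdges C).Finite ∧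
  (∀ e, C e ≠ none → ¬e.IsDiag) ∧
  -- the essential subgraphs are pairwise vertex-disjoint
  D.PartsDisjoint ∧
  -- (A): `L = ∅` or `L` is a limb and a component of `C`
  (∀ x, D.L = some x → IsLimb C x ∧ LimbComponent C x) ∧
  -- (B): `G0 = ∅` or `G0` is a blue path, `G0 ∪ Red_H(G0)` is a component,
  -- and `|Red_H(G0)| ≤ ⌈2 v(G0)/5⌉ - 1`
  (∀ l, D.G0 = some l → IsBluePath C l ∧ G0Component C l ∧
    (RedAt C {v | v ∈ l}).ncard + 1 ≤ (2 * l.length + 4) / 5) ∧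
  -- (C): `G2 = ∅` or `G2` is an extended (2,0)-path on ≥ 3 vertices
  (∀ l, D.G2 = some l → IsExtPath C l) ∧
  -- (C): `G1 = ∅` or `G1` is a blue (1,1)-path whose 1-ends are not adjacent
  -- to the blue end, the red end or the transition vertex of `G2`
  (∀ l, D.G1 = some l → IsBlue11Path C l ∧
    ∀ l2, D.G2 = some l2 → ∀ a, IsEnd a l → ∀ b : ℕ,
      (l2.head? = some b ∨ l2.getLast? = some b ∨ l2.dropLast.getLast? = some b) →
      ¬Adj C a b) ∧
  -- (C): `Blue_H(G1 ∪ G2) \ E(G1 ∪ G2) = ∅`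
  (∀ e, C e = some false → (∃ v ∈ e, v ∈ listOf D.G1 ∨ v ∈ listOf D.G2) →
    IsPathEdge (listOf D.G1) e ∨ IsPathEdge (listOf D.G2) e) ∧
  -- (C): `|Red_H(G1 ∪ G2)| ≤ ⌈2 v(G1 ∪ G2)/5⌉`
  (RedAt C {v | v ∈ listOf D.G1 ∨ v ∈ listOf D.G2}).ncard ≤
    (2 * (D.vG1 + D.vG2) + 4) / 5 ∧
  -- (D), (E): every edge of `C` has an end among the essential vertices
  (∀ e, C e ≠ none → ∃ v ∈ e, v ∈ D.verts) ∧
  -- (F)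
  (5 ∣ D.vG0 ∨ 5 ∣ D.vG1 + D.vG2)

/-- `C` is a very good graph with essential subgraphs `D`: condition (G). -/
def IsVeryGood (C : Coloring) (D : GoodData) : Prop :=
  IsGood C D ∧ 5 ∣ D.vG0 ∧ 5 ∣ D.vG1 + D.vG2

open Classical in
/-- Delete from `C` the vertices of `S` together with all incident edges. -/
noncomputable def deleteVerts (C : Coloring) (S : Set ℕ) : Coloring :=
  fun e => if ∃ v ∈ e, v ∈ S then none else C e

/-- The union of two (edge-disjoint) coloured graphs. -/
def unionCol (C C' : Coloring) : Coloring :=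
  fun e => match C e with
    | some c => some c
    | none => C' e

end OSR

namespace OSR

/-! ### Builder's side: positions with a forced win -/

/-- Builder can force the end of the `(P_4, P_n)` game from `C` within `N` further rounds. -/
def Win (n : ℕ) : ℕ → Coloring → Prop
  | 0, C => Ends 4 n C
  | N + 1, C => Ends 4 n C ∨ ∃ e : Sym2 ℕ, ¬e.IsDiag ∧ C e = none ∧
      ∀ c, Win n N (Function.update C e (some c))

lemma Win.of_ends {n N : ℕ} {C : Coloring} (h : Ends 4 n C) : Win n N C := by
  cases N with
  | zero => exact h
  | succ N => exact Or.inl h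

lemma Win.succ {n N : ℕ} {C : Coloring} (h : Win n N C) : Win n (N + 1) C := by
  induction N generalizing C with
  | zero => exact Or.inl h
  | succ N ih =>
    rcases h with h | ⟨e, he, hC, h⟩
    · exact Or.inl h
    · exact Or.inr ⟨e, he, hC, fun c => ih (h c)⟩

/-- `l` is the vertex sequence of a blue walk from `a` to `b`. -/
def BlueFrom (C : Coloring) (a b : ℕ) (l : List ℕ) : Prop :=
  l.head? = some a ∧ l.getLast? = some b ∧ l.IsChain fun x y => C s(x, y) = some false

/-- The labels `< L` are interpreted by distinct vertices through `φ`, the labelled edges in `red`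
are red, and the pairs in `paths` are the end pairs of disjoint blue paths which together lack at
most `T` blue edges to make up a blue path on `n` vertices. -/
def Realizes (C : Coloring) (n : ℕ) (φ : ℕ → ℕ) (L T : ℕ) (paths red : List (ℕ × ℕ)) : Prop :=
  Set.InjOn φ {i | i < L} ∧ (∀ e ∈ red, C s(φ e.1, φ e.2) = some true) ∧
    ∃ ls : List (List ℕ), List.Forall₂ (fun p l => BlueFrom C (φ p.1) (φ p.2) l) paths ls ∧
      ls.flatten.Nodup ∧ n + paths.length ≤ ls.flatten.length + T + 1

lemma BlueFrom.mono {C C' : Coloring} (hC : ∀ e c, C e = some c → C' e = some c) {a b : ℕ}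
    {l : List ℕ} (h : BlueFrom C a b l) : BlueFrom C' a b l :=
  ⟨h.1, h.2.1, h.2.2.imp fun _ _ hxy => hC _ _ hxy⟩

lemma BlueFrom.reverse {C : Coloring} {a b : ℕ} {l : List ℕ} (h : BlueFrom C a b l) :
    BlueFrom C b a l.reverse := by
  refine ⟨by simpa using h.2.1, by simpa using h.1, ?_⟩
  rw [List.isChain_reverse]
  exact h.2.2.imp fun x y hxy => by rwa [Sym2.eq_swap]

lemma BlueFrom.append {C : Coloring} {a b c d : ℕ} {l l' : List ℕ} (h : BlueFrom C a b l)
    (h' : BlueFrom C c d l') (hbc : C s(b, c) = some false) : BlueFrom C a d (l ++ l') := by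
  obtain ⟨h1, h2, h3⟩ := h
  obtain ⟨h1', h2', h3'⟩ := h'
  refine ⟨by simp [h1], by simp [h2'], ?_⟩
  rw [List.isChain_append]
  refine ⟨h3, h3', fun x hx y hy => ?_⟩
  simp_all

lemma BlueFrom.length_eq_one {C : Coloring} {a : ℕ} {l : List ℕ} (h : BlueFrom C a a l)
    (hl : l.Nodup) : l.length = 1 := by
  obtain ⟨h1, h2, -⟩ := h
  match l with
  | [] => simp at h1
  | [x] => rfl
  | x :: y :: t =>
    exfalso
    simp only [List.head?_cons, Option.some.injEq] at h1
    rw [List.getLast?_cons_cons] at h2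
    have := List.mem_of_getLast? h2
    subst h1
    simp_all

namespace Realizes

variable {C : Coloring} {n : ℕ} {φ : ℕ → ℕ} {L T : ℕ} {ps ps' red : List (ℕ × ℕ)}

lemma mono {C' : Coloring} (hC : ∀ e c, C e = some c → C' e = some c)
    (h : Realizes C n φ L T ps red) : Realizes C' n φ L T ps red := by
  obtain ⟨h1, h2, ls, h3, h4⟩ := h
  exact ⟨h1, fun e he => hC _ _ (h2 e he), ls, h3.imp fun _ _ h => h.mono hC, h4⟩

lemma perm (hp : ps.Perm ps') (h : Realizes C n φ L T ps red) :
    Realizes C n φ L T ps' red := by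
  obtain ⟨h1, h2, ls, h3, h4, h5⟩ := h
  obtain ⟨ls', h6, h7⟩ := List.perm_comp_forall₂ hp.symm h3
  refine ⟨h1, h2, ls', h6, h7.symm.flatten.nodup h4, ?_⟩
  rw [← hp.length_eq, h7.flatten.length_eq]
  exact h5

lemma swap {p : ℕ × ℕ} (h : Realizes C n φ L T (p.swap :: ps) red) :
    Realizes C n φ L T (p :: ps) red := by
  obtain ⟨h1, h2, ls, h3, h4, h5⟩ := h
  obtain ⟨l, ls, h6, h7, rfl⟩ := List.forall₂_cons_left_iff.1 h3
  refine ⟨h1, h2, l.reverse :: ls, .cons (by simpa using h6.reverse) h7, ?_, ?_⟩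
  · have : (l ++ ls.flatten).Perm (l.reverse ++ ls.flatten) :=
      (List.reverse_perm l).symm.append_right _
    simpa using this.nodup (by simpa using h4)
  · simpa using h5

lemma tail {p : ℕ × ℕ} (hp : p.1 = p.2) (h : Realizes C n φ L T (p :: ps) red) :
    Realizes C n φ L T ps red := by
  obtain ⟨h1, h2, ls, h3, h4, h5⟩ := h
  obtain ⟨l, ls, h6, h7, rfl⟩ := List.forall₂_cons_left_iff.1 h3
  rw [List.flatten_cons, List.nodup_append] at h4
  rw [hp] at h6
  have := h6.length_eq_one h4.1
  refine ⟨h1, h2, ls, h7, h4.2.1, ?_⟩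
  simp at h5
  simp
  omega

lemma merge {x a b y : ℕ} (h : Realizes C n φ L (T + 1) ((x, a) :: (b, y) :: ps) red)
    (hab : C s(φ a, φ b) = some false) : Realizes C n φ L T ((x, y) :: ps) red := by
  obtain ⟨h1, h2, ls, h3, h4, h5⟩ := h
  obtain ⟨l, ls, h6, h7, rfl⟩ := List.forall₂_cons_left_iff.1 h3
  obtain ⟨l', ls, h8, h9, rfl⟩ := List.forall₂_cons_left_iff.1 h7
  refine ⟨h1, h2, (l ++ l') :: ls, .cons (h6.append h8 hab) h9, by simpa using h4, ?_⟩
  simp at h5 ⊢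
  omega

lemma ne {x a b y : ℕ} (h : Realizes C n φ L T ((x, a) :: (b, y) :: ps) red) : φ a ≠ φ b := by
  obtain ⟨h1, h2, ls, h3, h4, h5⟩ := h
  obtain ⟨l, ls, h6, h7, rfl⟩ := List.forall₂_cons_left_iff.1 h3
  obtain ⟨l', ls, h8, h9, rfl⟩ := List.forall₂_cons_left_iff.1 h7
  have ha : φ a ∈ l := List.mem_of_getLast? h6.2.1
  have hb : φ b ∈ l' := List.mem_of_head? h8.1
  rw [List.flatten_cons, List.nodup_append] at h4
  exact h4.2.2 _ ha _ (by simp [hb])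

lemma addRed {e : ℕ × ℕ} (h : Realizes C n φ L T ps red)
    (he : C s(φ e.1, φ e.2) = some true) : Realizes C n φ L T ps (e :: red) :=
  ⟨h.1, by simpa using ⟨he, fun a b hab => h.2.1 (a, b) hab⟩, h.2.2⟩

end Realizes

/-- All labels occurring in `ps` are `< L`. -/
def LabelsBelow (L : ℕ) (ps : List (ℕ × ℕ)) : Prop := ∀ p ∈ ps, p.1 < L ∧ p.2 < L

instance (L : ℕ) (ps : List (ℕ × ℕ)) : Decidable (LabelsBelow L ps) :=
  inferInstanceAs (Decidable (∀ p ∈ ps, p.1 < L ∧ p.2 < L))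

/-- Adjoin `k` one-vertex paths with new labels. -/
def withFresh (L k : ℕ) (ps : List (ℕ × ℕ)) : List (ℕ × ℕ) :=
  ps ++ (List.range k).map fun i => (L + i, L + i)

lemma LabelsBelow.withFresh {L : ℕ} {ps : List (ℕ × ℕ)} (h : LabelsBelow L ps) (k : ℕ) :
    LabelsBelow (L + k) (withFresh L k ps) := by
  intro p hp
  simp only [OSR.withFresh, List.mem_append, List.mem_map, List.mem_range] at hp
  rcases hp with hp | ⟨i, hi, rfl⟩
  · have := h p hp
    omega
  · simp only
    omega

lemma Realizes.fresh_one {C : Coloring} {n : ℕ} {φ : ℕ → ℕ} {L T : ℕ} {ps red : List (ℕ × ℕ)}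
    (hps : LabelsBelow L ps) (hred : LabelsBelow L red) (h : Realizes C n φ L T ps red) :
    ∃ ψ, Realizes C n ψ (L + 1) T (ps ++ [(L, L)]) red := by
  obtain ⟨h1, h2, ls, h3, h4, h5⟩ := h
  obtain ⟨v, hv⟩ := Infinite.exists_notMem_finset
    (ls.flatten.toFinset ∪ (Finset.range L).image φ)
  simp only [Finset.mem_union, List.mem_toFinset, Finset.mem_image, Finset.mem_range,
    not_or, not_exists, not_and] at hv
  have hψ : ∀ i, i < L → Function.update φ L v i = φ i := fun i hi =>
    Function.update_of_ne hi.ne _ _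
  refine ⟨Function.update φ L v, ?_, ?_, ls ++ [[v]], ?_, ?_, ?_⟩
  · intro i hi j hj hij
    simp only [Set.mem_ofPred_eq] at hi hj
    rcases Nat.lt_succ_iff_lt_or_eq.1 hi with hi | rfl <;>
      rcases Nat.lt_succ_iff_lt_or_eq.1 hj with hj | rfl
    · rw [hψ i hi, hψ j hj] at hij
      exact h1 hi hj hij
    · rw [hψ i hi, Function.update_self] at hij
      exact absurd hij (hv.2 i hi)
    · rw [hψ j hj, Function.update_self] at hij
      exact absurd hij.symm (hv.2 j hj)
    · rfl
  · intro e he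
    rw [hψ _ (hred e he).1, hψ _ (hred e he).2]
    exact h2 e he
  · refine List.rel_append (R := fun p l => _) ?_ (.cons ?_ .nil)
    · rw [List.forall₂_iff_get] at h3 ⊢
      refine ⟨h3.1, fun i hi hi' => ?_⟩
      have := hps (ps.get ⟨i, hi⟩) (List.get_mem _ _)
      rw [hψ _ this.1, hψ _ this.2]
      exact h3.2 i hi hi'
    · simp [BlueFrom]
  · simp only [List.flatten_append, List.flatten_cons, List.flatten_nil, List.append_nil]
    rw [List.nodup_append]
    refine ⟨h4, List.nodup_singleton _, fun x hx y hy => ?_⟩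
    rw [List.mem_singleton] at hy
    rintro rfl
    subst hy
    exact hv.1 hx
  · simp only [List.length_append, List.flatten_append, List.flatten_cons, List.flatten_nil,
      List.length_cons, List.length_nil, List.append_nil]
    omega

lemma Realizes.fresh {C : Coloring} {n : ℕ} {φ : ℕ → ℕ} {L T : ℕ} {ps red : List (ℕ × ℕ)}
    (hps : LabelsBelow L ps) (hred : LabelsBelow L red) (h : Realizes C n φ L T ps red) (k : ℕ) :
    ∃ ψ, Realizes C n ψ (L + k) T (withFresh L k ps) red := by
  induction k with
  | zero => exact ⟨φ, by simpa [withFresh] using h⟩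
  | succ k ih =>
    obtain ⟨ψ, hψ⟩ := ih
    have hred' : LabelsBelow (L + k) red := fun e he => by
      have := hred e he
      omega
    obtain ⟨χ, hχ⟩ := hψ.fresh_one (hps.withFresh k) hred'
    refine ⟨χ, ?_⟩
    simpa [withFresh, List.range_succ, add_assoc] using hχ

/-- Remove one copy of the path `p`, in either orientation. -/
def extract (p : ℕ × ℕ) (src : List (ℕ × ℕ)) : Option (List (ℕ × ℕ)) :=
  if p ∈ src then some (src.erase p)
  else if p.swap ∈ src then some (src.erase p.swap) else none

/-- The paths `tgt` occur in `src` up to orientation, and the others are singletons. -/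
def matchAll : List (ℕ × ℕ) → List (ℕ × ℕ) → Bool
  | [], src => src.all fun p => p.1 == p.2
  | q :: qs, src =>
    match extract q src with
    | some src' => matchAll qs src'
    | none => false

/-- Some three of the edges `E` form a path on four labels `< L`. -/
def hasPathFour (L : ℕ) (E : List (ℕ × ℕ)) : Bool :=
  let E' := E ++ E.map Prod.swap
  E'.any fun p => E'.any fun q => E'.any fun r =>
    p.2 == q.1 && q.2 == r.1 && decide [p.1, p.2, r.1, r.2].Nodup &&
      [p.1, p.2, r.1, r.2].all (· < L)

/-- A move of Builder, with the types of the positions it leads to. -/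
structure Move where
  /-- the number of new vertices to be used -/
  fresh : ℕ
  /-- the selected edge joins the ends `a` and `b` of the paths `(x, a)` and `(b, y)` -/
  x : ℕ
  a : ℕ
  b : ℕ
  y : ℕ
  /-- the type of the position after a blue answer, and the labels it has there -/
  blue : ℕ × List ℕ
  /-- the same for a red answer, or `none` if that answer completes a red `P_4` -/
  red : Option (ℕ × List ℕ)

/-- A type of position, with the number of rounds Builder needs from there and his moves. -/
structure Node where
  labels : ℕ
  paths : List (ℕ × ℕ)
  red : List (ℕ × ℕ)
  /-- for few missing blue edges, the number of further rounds in excess of these that suffice -/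
  spare : List (ℕ × ℕ)
  moves : List Move

/-- The number of rounds in excess of `T` that suffice if `T` blue edges are missing. -/
def Node.spareAt (nd : Node) (T : ℕ) : Option ℕ :=
  if T < 6 then nd.spare.lookup T
  else (nd.spare.lookup (6 + (T - 6) % 5)).map (· + 2 * ((T - 6) / 5))

lemma Node.spareAt_add_five (nd : Node) {T : ℕ} (hT : 6 ≤ T) :
    nd.spareAt (T + 5) = (nd.spareAt T).map (· + 2) := by
  rw [spareAt, spareAt, if_neg (by omega), if_neg (by omega),
    show (T + 5 - 6) % 5 = (T - 6) % 5 by omega, show (T + 5 - 6) / 5 = (T - 6) / 5 + 1 by omega,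
    Option.map_map]
  rfl

/-- The position with labels `< L`, paths `ps` and red edges `red` is of type `nd`, the labels of
`nd` being interpreted through `μ`. -/
def Node.embeds (nd : Node) (μ : List ℕ) (L : ℕ) (ps red : List (ℕ × ℕ)) : Bool :=
  let f := fun p : ℕ × ℕ => (μ.getD p.1 0, μ.getD p.2 0)
  μ.length == nd.labels && decide μ.Nodup && μ.all (· < L) &&
    (nd.red.map f).all (fun e => e ∈ red || e.swap ∈ red) && matchAll (nd.paths.map f) ps

/-- The labels of `nd` are in range. -/
def Node.wf (nd : Node) : Bool :=
  decide (LabelsBelow nd.labels nd.paths) && decide (LabelsBelow nd.labels nd.red)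

/-- A table of types of positions. -/
abbrev Table := List Node

/-- The entry of a table with number `i`. -/
def Table.node (tab : Table) (i : ℕ) : Node := tab.getD i ⟨0, [], [], [], []⟩

/-- The answers to the move `m` lead to positions of the given types. -/
def Table.moveOK (tab : Table) (nd : Node) (m : Move) : Bool :=
  let L := nd.labels + m.fresh
  let ps := withFresh nd.labels m.fresh nd.paths
  let red := (m.a, m.b) :: nd.red
  decide (m.a < L) && decide (m.b < L) &&
  (match extract (m.x, m.a) ps with
    | none => false
    | some ps' => match extract (m.b, m.y) ps' with
      | none => false
      | some ps'' => (tab.node m.blue.1).embeds m.blue.2 L ((m.x, m.y) :: ps'') nd.red) &&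
  match m.red with
    | none => hasPathFour L red
    | some r => (tab.node r.1).embeds r.2 L ps red

/-- The move `m` is good enough if `T` blue edges are missing and `v` further rounds are spare. -/
def Table.timeOK (tab : Table) (m : Move) (T v : ℕ) : Bool :=
  ((tab.node m.blue.1).spareAt (T - 1)).any (· ≤ v) &&
    match m.red with
    | none => true
    | some r => ((tab.node r.1).spareAt T).any (· + 1 ≤ v)

/-- If `T` blue edges are missing, the entry has a good move, or is a win already for `T = 0`. -/
def Table.entryOK (tab : Table) (nd : Node) (T : ℕ) : Bool :=
  (nd.spareAt T).all fun v =>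
    if T = 0 then !nd.paths.isEmpty && nd.paths.tail.all fun p => p.1 == p.2
    else nd.moves.any fun m => tab.timeOK m T v

/-- All entries of the table are correct. -/
def Table.OK (tab : Table) : Bool :=
  tab.all fun nd => nd.wf && nd.moves.all (tab.moveOK nd) &&
    (List.range 12).all (tab.entryOK nd)

lemma Table.timeOK_add_five {tab : Table} {m : Move} {T v : ℕ} (hT : 7 ≤ T)
    (h : tab.timeOK m T v) : tab.timeOK m (T + 5) (v + 2) := by
  rw [timeOK, Bool.and_eq_true] at h ⊢
  rw [show T + 5 - 1 = T - 1 + 5 by omega, Node.spareAt_add_five _ (by omega : 6 ≤ T - 1)]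
  refine ⟨?_, ?_⟩
  · have := h.1
    simp only [Option.any_map, add_le_add_iff_right] at this ⊢
    exact this
  · have := h.2
    cases hr : m.red with
    | none => rfl
    | some r =>
      rw [hr] at this
      simp only [Node.spareAt_add_five _ (by omega : 6 ≤ T), Option.any_map] at this ⊢
      convert this using 3
      simp

lemma Table.entryOK_all {tab : Table} {nd : Node} (h : ∀ T < 12, tab.entryOK nd T) (T : ℕ) :
    tab.entryOK nd T := by
  induction T using Nat.strong_induction_on with
  | _ T ih =>
    by_cases hT : T < 12
    · exact h T hT
    · obtain ⟨T, rfl⟩ : ∃ S, T = S + 5 := ⟨T - 5, by omega⟩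
      have := ih T (by omega)
      rw [entryOK] at this ⊢
      rw [Node.spareAt_add_five _ (by omega)]
      simp only [show ¬T + 5 = 0 by omega, show ¬T = 0 by omega, if_false] at this ⊢
      cases hv : nd.spareAt T with
      | none => rfl
      | some v =>
        simp only [hv, Option.all_some, List.any_eq_true, Option.map_some] at this ⊢
        obtain ⟨m, hm, h⟩ := this
        exact ⟨m, hm, timeOK_add_five (by omega) h⟩

lemma Realizes.extract {C : Coloring} {n : ℕ} {φ : ℕ → ℕ} {L T : ℕ} {ps ps' acc red : List (ℕ × ℕ)}
    {p : ℕ × ℕ} (hp : OSR.extract p ps = some ps') (h : Realizes C n φ L T (ps ++ acc) red) :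
    Realizes C n φ L T (p :: (ps' ++ acc)) red := by
  unfold OSR.extract at hp
  split_ifs at hp with h1 h2
  · obtain rfl := Option.some.inj hp
    exact h.perm ((List.perm_cons_erase h1).append_right acc)
  · obtain rfl := Option.some.inj hp
    exact (h.perm ((List.perm_cons_erase h2).append_right acc)).swap

lemma Realizes.matchAll {C : Coloring} {n : ℕ} {φ : ℕ → ℕ} {L T : ℕ}
    {qs ps acc red : List (ℕ × ℕ)} (hm : OSR.matchAll qs ps)
    (h : Realizes C n φ L T (ps ++ acc) red) : Realizes C n φ L T (qs ++ acc) red := by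
  induction qs generalizing ps acc with
  | nil =>
    induction ps with
    | nil => exact h
    | cons p ps ih =>
      simp only [OSR.matchAll, List.all_cons, Bool.and_eq_true, beq_iff_eq] at hm ih
      exact ih hm.2 (Realizes.tail hm.1 h)
  | cons q qs ih =>
    rw [OSR.matchAll] at hm
    split at hm
    · rename_i ps' hps'
      have := (h.extract hps').perm (List.perm_middle (l₁ := ps')).symm
      exact (ih hm this).perm List.perm_middle
    · simp at hm

lemma getD_lt_of_all {μ : List ℕ} {L : ℕ} (h : μ.all (· < L)) {i : ℕ} (hi : i < μ.length) :
    μ.getD i 0 < L := by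
  rw [List.getD_eq_getElem _ _ hi]
  simpa using List.all_eq_true.1 h _ (List.getElem_mem hi)

lemma Realizes.embeds {C : Coloring} {n : ℕ} {φ : ℕ → ℕ} {L T : ℕ} {ps red : List (ℕ × ℕ)}
    {nd : Node} {μ : List ℕ} (hm : nd.embeds μ L ps red) (h : Realizes C n φ L T ps red) :
    Realizes C n (fun i => φ (μ.getD i 0)) nd.labels T nd.paths nd.red := by
  simp only [Node.embeds, Bool.and_eq_true, beq_iff_eq, decide_eq_true_eq] at hm
  obtain ⟨⟨⟨⟨h1, h2⟩, h3⟩, h4⟩, h5⟩ := hm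
  rw [← List.append_nil ps] at h
  obtain ⟨h6, h7, ls, h8, h9⟩ := h.matchAll h5
  refine ⟨?_, ?_, ls, ?_, by simpa using h9⟩
  · intro i hi j hj hij
    simp only [Set.mem_ofPred_eq, ← h1] at hi hj
    have := h6 (getD_lt_of_all h3 hi) (getD_lt_of_all h3 hj) hij
    rw [List.getD_eq_getElem _ _ hi, List.getD_eq_getElem _ _ hj] at this
    exact (h2.getElem_inj_iff).1 this
  · intro e he
    simp only [List.all_map, List.all_eq_true, Function.comp, Bool.or_eq_true,
      decide_eq_true_eq] at h4
    rcases h4 e he with h | h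
    · exact h7 _ h
    · have := h7 _ h
      rwa [Sym2.eq_swap] at this
  · simpa [List.forall₂_map_left_iff] using h8

lemma hasPath_four {C : Coloring} {col : Bool} {a b c d : ℕ} (hnd : [a, b, c, d].Nodup)
    (hab : C s(a, b) = some col) (hbc : C s(b, c) = some col) (hcd : C s(c, d) = some col) :
    HasPath C col 4 := by
  refine ⟨[a, b, c, d].get, List.nodup_iff_injective_get.1 hnd, fun i j hij => ?_⟩
  fin_cases i <;> fin_cases j <;> simp_all

lemma Realizes.hasPathFour {C : Coloring} {n : ℕ} {φ : ℕ → ℕ} {L T : ℕ} {ps red : List (ℕ × ℕ)}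
    (hr : OSR.hasPathFour L red) (h : Realizes C n φ L T ps red) : HasPath C true 4 := by
  have hred : ∀ e ∈ red ++ red.map Prod.swap, C s(φ e.1, φ e.2) = some true := by
    intro e he
    simp only [List.mem_append, List.mem_map] at he
    rcases he with he | ⟨e, he, rfl⟩
    · exact h.2.1 e he
    · rw [Sym2.eq_swap]
      exact h.2.1 e he
  simp only [OSR.hasPathFour, List.any_eq_true, Bool.and_eq_true, beq_iff_eq,
    decide_eq_true_eq] at hr
  obtain ⟨⟨u, v⟩, hp, ⟨v', w'⟩, hq, ⟨w, z⟩, hr, ⟨⟨hv, hw⟩, hnd⟩, hlt⟩ := hr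
  obtain rfl : v = v' := hv
  obtain rfl : w' = w := hw
  simp only [List.all_cons, List.all_nil, Bool.and_eq_true, decide_eq_true_eq] at hlt
  have hnd' : [φ u, φ v, φ w', φ z].Nodup := by
    refine List.Nodup.map_on (f := φ) (l := [u, v, w', z]) (fun a ha b hb hab => ?_) hnd
    have hlt' : ∀ a ∈ [u, v, w', z], a < L := by simp [hlt]
    exact h.1 (hlt' a ha) (hlt' b hb) hab
  exact hasPath_four hnd' (hred _ hp) (hred _ hq) (hred _ hr)

lemma Realizes.hasPath {C : Coloring} {n : ℕ} {φ : ℕ → ℕ} {L : ℕ} {ps red : List (ℕ × ℕ)}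
    (hne : ps ≠ []) (hps : ps.tail.all fun p => p.1 == p.2) (h : Realizes C n φ L 0 ps red) :
    HasPath C false n := by
  match ps, hne with
  | p :: ps, _ =>
    obtain ⟨-, -, ls, h1, h2, h3⟩ := Realizes.matchAll (qs := []) (ps := ps) (acc := [p])
      (by simpa [OSR.matchAll] using hps) (h.perm (List.perm_append_singleton p ps).symm)
    obtain ⟨l, ls, h6, h7, rfl⟩ := List.forall₂_cons_left_iff.1 h1
    obtain rfl := List.forall₂_nil_left_iff.1 h7
    simp only [List.flatten_cons, List.flatten_nil, List.append_nil, List.nil_append,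
      List.length_singleton] at h2 h3
    refine ⟨fun i => l.get (i.castLE (by omega)), (List.nodup_iff_injective_get.1 h2).comp
      (Fin.castLE_injective (by omega)), fun i j hij => ?_⟩
    have := List.isChain_iff_getElem.1 h6.2.2 i (by omega)
    simpa [hij] using this

lemma Table.win {tab : Table} (hok : tab.OK) {n N : ℕ} : ∀ {nd : Node}, nd ∈ tab →
    ∀ {T v w : ℕ} {φ : ℕ → ℕ} {C : Coloring}, nd.spareAt T = some v → v ≤ w → N = T + w →
      Realizes C n φ nd.labels T nd.paths nd.red → Win n N C := by
  have hmem : ∀ (i : ℕ) T v, (tab.node i).spareAt T = some v → tab.node i ∈ tab := by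
    intro i T v h
    by_cases hi : i < tab.length
    · rw [Table.node, List.getD_eq_getElem _ _ hi]
      exact List.getElem_mem hi
    · rw [Table.node, List.getD_eq_default _ _ (by omega)] at h
      simp [Node.spareAt] at h
  simp only [Table.OK, List.all_eq_true, Bool.and_eq_true, List.mem_range] at hok
  induction N with
  | zero =>
    intro nd hnd T v w φ C hv hvw hN h
    obtain rfl : T = 0 := by omega
    have := Table.entryOK_all (hok nd hnd).2 0
    simp only [entryOK, hv, Option.all_some, if_true, Bool.and_eq_true] at this
    exact Or.inr (h.hasPath (by simpa using this.1) this.2)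
  | succ N ih =>
    intro nd hnd T v w φ C hv hvw hN h
    have hent := Table.entryOK_all (hok nd hnd).2 T
    simp only [entryOK, hv, Option.all_some] at hent
    split_ifs at hent with hT
    · subst hT
      rw [Bool.and_eq_true] at hent
      exact .of_ends (Or.inr (h.hasPath (by simpa using hent.1) hent.2))
    · obtain ⟨m, hm, htime⟩ := List.any_eq_true.1 hent
      have hmove := (hok nd hnd).1.2 m hm
      have hwf := (hok nd hnd).1.1
      simp only [Node.wf, Bool.and_eq_true, decide_eq_true_eq] at hwf
      obtain ⟨ψ, hψ⟩ := h.fresh hwf.1 hwf.2 m.fresh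
      simp only [moveOK, Bool.and_eq_true, decide_eq_true_eq] at hmove
      obtain ⟨⟨⟨ha, hb⟩, hblue⟩, hred⟩ := hmove
      simp only [timeOK, Bool.and_eq_true] at htime
      split at hblue
      · simp at hblue
      rename_i ps' hps'
      split at hblue
      · simp at hblue
      rename_i ps'' hps''
      have hpaths : Realizes C n ψ (nd.labels + m.fresh) T ((m.x, m.a) :: (m.b, m.y) :: ps'')
          nd.red := by
        have h1 := Realizes.extract (acc := []) hps' (by simpa using hψ)
        rw [List.append_nil] at h1
        have h2 := (h1.perm (List.perm_append_singleton _ _).symm).extract hps''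
        exact h2.perm ((List.Perm.cons _ (List.perm_append_singleton _ _)).trans
          (List.Perm.swap _ _ _))
      have step : ∀ (C' : Coloring) (c : Bool), (∀ e c, C e = some c → C' e = some c) →
          C' s(ψ m.a, ψ m.b) = some c → Win n N C' := by
        intro C' c hC hc
        cases c with
        | false =>
          obtain ⟨vb, hvb, hle⟩ := (Option.any_eq_true _ _).1 htime.1
          obtain ⟨S, rfl⟩ := Nat.exists_eq_succ_of_ne_zero hT
          exact ih (hmem _ _ _ hvb) hvb (by simp at hle; omega) (by omega : N = S + w)
            (((hpaths.mono hC).merge hc).embeds hblue)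
        | true =>
          have hR := (hψ.mono hC).addRed (e := (m.a, m.b)) hc
          split at hred
          · exact .of_ends (Or.inl (hR.hasPathFour hred))
          · rename_i r hr
            have h2 := htime.2
            rw [hr] at h2
            obtain ⟨vr, hvr, hle⟩ := (Option.any_eq_true _ _).1 h2
            simp only [decide_eq_true_eq] at hle
            exact ih (hmem _ _ _ hvr) hvr (by omega) (by omega : N = T + (w - 1))
              (hR.embeds hred)
      cases hCe : C s(ψ m.a, ψ m.b) with
      | some c => exact (step C c (fun _ _ h => h) hCe).succ
      | none =>
        refine Or.inr ⟨s(ψ m.a, ψ m.b), by simpa using hpaths.ne, hCe, fun c => ?_⟩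
        refine step _ c (fun e d hd => ?_) (Function.update_self ..)
        rw [Function.update_of_ne, hd]
        rintro rfl
        simp [hCe] at hd

/-- Builder's strategy. -/
def strategyTable : Table := [
  ⟨1, [(0, 0)], [],
    [(6, 3), (7, 4), (8, 4), (9, 4), (10, 5)],
    [⟨2, 0, 0, 1, 1, (2, [0, 1]), some (1, [2, 0, 1])⟩]⟩,
  ⟨3, [(0, 0), (1, 1), (2, 2)], [(1, 2)],
    [(6, 2), (7, 3), (8, 3), (9, 3), (10, 4)],
    [⟨0, 0, 0, 1, 1, (2, [0, 1]), some (5, [0, 2, 1])⟩,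
      ⟨1, 0, 0, 1, 1, (4, [1, 0, 2, 3]), some (5, [0, 2, 1])⟩,
      ⟨0, 0, 0, 1, 1, (12, [0, 1, 2]), some (5, [0, 2, 1])⟩]⟩,
  ⟨2, [(0, 1)], [],
    [(0, 0), (4, 2), (5, 3), (6, 3), (7, 4), (8, 4), (9, 4), (10, 5)],
    [⟨2, 2, 2, 3, 3, (6, [0, 1, 2, 3]), some (3, [0, 1, 2, 3])⟩,
      ⟨2, 2, 2, 3, 3, (6, [0, 1, 2, 3]), some (10, [0, 1, 2, 3])⟩]⟩,
  ⟨4, [(0, 1), (2, 2), (3, 3)], [(2, 3)],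
    [(4, 1), (5, 2), (6, 2), (8, 3), (9, 3)],
    [⟨1, 2, 2, 4, 4, (8, [2, 4, 0, 1, 3]), some (7, [0, 1, 3, 4, 2])⟩,
      ⟨1, 2, 2, 4, 4, (20, [4, 2, 0, 1, 3]), some (7, [0, 1, 3, 4, 2])⟩]⟩,
  ⟨4, [(0, 1), (2, 2), (3, 3)], [(0, 2)],
    [(7, 3), (8, 3)],
    [⟨0, 2, 2, 3, 3, (11, [0, 1, 2, 3]), some (9, [0, 1, 3, 2])⟩]⟩,
  ⟨3, [(0, 0), (1, 1), (2, 2)], [(2, 0), (2, 1)],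
    [(6, 1), (7, 2), (8, 2), (9, 2), (10, 3)],
    [⟨1, 0, 0, 3, 3, (9, [0, 3, 1, 2]), none⟩,
      ⟨1, 0, 0, 3, 3, (21, [0, 3, 2, 1]), none⟩]⟩,
  ⟨4, [(0, 1), (2, 3)], [],
    [(1, 2), (2, 2), (3, 2), (4, 3), (5, 3), (6, 4), (7, 4), (8, 4), (9, 5), (10, 5)],
    [⟨1, 0, 1, 4, 4, (6, [0, 4, 2, 3]), some (8, [1, 0, 2, 3, 4])⟩,
      ⟨1, 0, 1, 4, 4, (6, [0, 4, 2, 3]), some (20, [0, 1, 2, 3, 4])⟩,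
      ⟨0, 0, 1, 2, 3, (2, [0, 3]), some (11, [1, 0, 2, 3])⟩]⟩,
  ⟨5, [(0, 1), (2, 2), (3, 3), (4, 4)], [(4, 2), (4, 3)],
    [(4, 0), (5, 1), (6, 1), (8, 2), (9, 2)],
    [⟨0, 0, 1, 2, 2, (9, [2, 0, 3, 4]), none⟩]⟩,
  ⟨5, [(0, 1), (2, 3), (4, 4)], [(0, 4)],
    [(2, 1), (3, 1), (4, 2), (5, 2), (7, 3), (8, 3), (10, 4)],
    [⟨1, 1, 0, 5, 5, (17, [1, 5, 2, 3, 4, 0]), some (16, [2, 3, 1, 0, 4, 5])⟩,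
      ⟨0, 1, 0, 2, 3, (2, [1, 3]), some (19, [3, 2, 1, 0, 4])⟩,
      ⟨0, 1, 0, 2, 3, (10, [1, 3, 4, 0]), some (19, [3, 2, 1, 0, 4])⟩]⟩,
  ⟨4, [(0, 1), (2, 2), (3, 3)], [(3, 0), (3, 2)],
    [(3, 0), (4, 1), (5, 1), (7, 2), (8, 2), (9, 3), (10, 3)],
    [⟨1, 1, 0, 4, 4, (3, [1, 4, 2, 3]), none⟩,
      ⟨1, 1, 0, 4, 4, (15, [1, 4, 2, 3, 0]), none⟩]⟩,
  ⟨4, [(0, 1), (2, 2)], [(2, 3)],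
    [(1, 1), (2, 1), (5, 2), (7, 3), (10, 4)],
    [⟨2, 4, 4, 5, 5, (17, [0, 1, 4, 5, 2, 3]), some (22, [0, 1, 2, 4, 5, 3])⟩,
      ⟨1, 2, 2, 4, 4, (20, [4, 2, 0, 1, 3]), some (15, [0, 1, 4, 2, 3])⟩,
      ⟨0, 0, 1, 2, 2, (12, [0, 2, 3]), some (21, [1, 0, 2, 3])⟩]⟩,
  ⟨4, [(0, 1), (2, 3)], [(0, 2)],
    [(1, 1), (6, 3), (7, 3)],
    [⟨0, 0, 1, 2, 3, (2, [0, 3]), some (23, [2, 3, 0, 1])⟩]⟩,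
  ⟨3, [(0, 1)], [(1, 2)],
    [(0, 0), (1, 1), (5, 2), (7, 3), (10, 4)],
    [⟨2, 3, 3, 4, 4, (20, [0, 1, 3, 4, 2]), some (14, [0, 1, 3, 4, 2])⟩,
      ⟨1, 1, 0, 3, 3, (2, [1, 3]), some (13, [0, 1, 3, 2])⟩]⟩,
  ⟨4, [(0, 1), (2, 2)], [(0, 2), (1, 3)],
    [(1, 0)],
    [⟨0, 0, 1, 2, 2, (2, [0, 2]), none⟩]⟩,
  ⟨5, [(0, 1), (2, 2), (3, 3)], [(1, 4), (2, 3)],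
    [(5, 1), (7, 2), (10, 3)],
    [⟨1, 2, 2, 5, 5, (24, [2, 5, 0, 1, 3, 4]), some (26, [0, 1, 3, 5, 2, 4])⟩]⟩,
  ⟨5, [(0, 1), (2, 2), (3, 3)], [(3, 2), (3, 4)],
    [(2, 0), (3, 1), (4, 1), (7, 2), (8, 3), (9, 3)],
    [⟨1, 2, 2, 5, 5, (8, [2, 5, 0, 1, 3]), none⟩,
      ⟨0, 0, 1, 2, 2, (21, [2, 0, 3, 4]), none⟩]⟩,
  ⟨6, [(0, 1), (2, 3), (4, 4), (5, 5)], [(3, 4), (3, 5)],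
    [(4, 1), (5, 1)],
    [⟨0, 0, 1, 4, 4, (19, [0, 4, 2, 3, 5]), none⟩]⟩,
  ⟨6, [(0, 1), (2, 3), (4, 4)], [(4, 5)],
    [(3, 2), (4, 2), (8, 4), (9, 4)],
    [⟨0, 0, 1, 4, 4, (6, [0, 4, 2, 3]), some (8, [1, 0, 2, 3, 4])⟩,
      ⟨1, 0, 1, 6, 6, (17, [0, 6, 2, 3, 4, 5]), some (27, [1, 0, 2, 3, 6, 4, 5])⟩]⟩,
  ⟨6, [(0, 1), (2, 3), (4, 5)], [(0, 2)],
    [(2, 1), (7, 3)],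
    [⟨0, 1, 0, 4, 5, (20, [3, 2, 1, 5, 0]), some (28, [3, 2, 5, 4, 1, 0])⟩]⟩,
  ⟨5, [(0, 1), (2, 3), (4, 4)], [(3, 1), (3, 4)],
    [(2, 0), (3, 0), (4, 1), (7, 2), (8, 2), (10, 3)],
    [⟨0, 1, 0, 4, 4, (23, [3, 2, 1, 4]), none⟩]⟩,
  ⟨5, [(0, 1), (2, 3)], [(1, 4)],
    [(1, 1), (4, 2), (6, 3), (9, 4)],
    [⟨1, 2, 3, 5, 5, (6, [0, 1, 2, 5]), some (24, [3, 2, 0, 1, 5, 4])⟩,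
      ⟨0, 0, 1, 2, 3, (2, [0, 3]), some (29, [3, 2, 0, 1, 4])⟩]⟩,
  ⟨4, [(0, 1), (2, 2)], [(2, 0), (2, 3)],
    [(1, 0), (2, 1), (6, 2)],
    [⟨1, 1, 0, 4, 4, (2, [1, 4]), none⟩,
      ⟨1, 1, 0, 4, 4, (10, [1, 4, 2, 0]), none⟩]⟩,
  ⟨6, [(0, 1), (2, 2), (3, 3), (4, 4)], [(2, 5), (3, 4)],
    [(5, 1), (10, 3)],
    [⟨0, 2, 2, 3, 3, (25, [3, 2, 0, 1, 4, 5]), none⟩]⟩,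
  ⟨4, [(0, 1), (2, 3)], [(0, 2), (0, 3)],
    [(1, 0), (2, 0), (3, 1), (6, 2), (7, 2), (9, 3)],
    [⟨1, 2, 3, 4, 4, (29, [4, 2, 1, 0, 3]), none⟩,
      ⟨0, 0, 1, 2, 3, (2, [0, 3]), none⟩]⟩,
  ⟨6, [(0, 1), (2, 3), (4, 4)], [(0, 4), (3, 5)],
    [(4, 1), (6, 2), (9, 3)],
    [⟨1, 4, 4, 6, 6, (32, [0, 1, 4, 6, 2, 3, 5]), some (33, [0, 1, 2, 3, 6, 4, 5])⟩,
      ⟨0, 1, 0, 3, 2, (10, [1, 2, 4, 0]), none⟩]⟩,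
  ⟨6, [(0, 1), (2, 3), (4, 4)], [(0, 4), (1, 5)],
    [(4, 1), (9, 3)],
    [⟨1, 4, 4, 6, 6, (34, [4, 6, 0, 1, 2, 3, 5]), some (35, [1, 0, 2, 3, 6, 4, 5])⟩]⟩,
  ⟨6, [(0, 1), (2, 2), (3, 3), (4, 4)], [(1, 5), (4, 2), (4, 3)],
    [(5, 0), (7, 1), (10, 2)],
    [⟨1, 2, 2, 6, 6, (33, [2, 6, 0, 1, 3, 4, 5]), none⟩]⟩,
  ⟨7, [(0, 1), (2, 3), (4, 4), (5, 5)], [(0, 4), (5, 6)],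
    [(4, 1), (9, 3)],
    [⟨0, 4, 4, 5, 5, (34, [0, 1, 4, 5, 2, 3, 6]), none⟩]⟩,
  ⟨6, [(0, 1), (2, 3), (4, 5)], [(5, 1), (5, 3)],
    [(2, 0), (7, 2)],
    [⟨0, 0, 1, 2, 3, (29, [0, 3, 4, 5, 1]), none⟩]⟩,
  ⟨5, [(0, 1), (2, 3)], [(3, 1), (3, 4)],
    [(1, 0), (2, 1), (5, 2), (6, 2), (8, 3), (10, 4)],
    [⟨0, 0, 1, 2, 3, (2, [0, 3]), none⟩,
      ⟨0, 0, 1, 2, 3, (12, [0, 3, 1]), none⟩]⟩,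
  ⟨4, [(0, 1), (2, 3)], [(1, 0), (1, 2)],
    [(2, 0), (7, 2)],
    [⟨1, 1, 0, 4, 4, (29, [3, 2, 4, 1, 0]), none⟩]⟩,
  ⟨6, [(0, 1), (2, 3), (4, 4)], [(4, 0), (4, 2), (3, 5)],
    [(3, 0), (8, 2)],
    [⟨0, 2, 3, 4, 4, (30, [2, 4, 0, 1]), none⟩]⟩,
  ⟨7, [(0, 1), (2, 3), (4, 5)], [(0, 2), (5, 6)],
    [(3, 1), (8, 3)],
    [⟨1, 4, 5, 7, 7, (18, [0, 1, 2, 3, 4, 7]), some (36, [0, 1, 2, 3, 5, 4, 7, 6])⟩]⟩,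
  ⟨7, [(0, 1), (2, 3), (4, 4), (5, 5)], [(5, 0), (5, 4), (3, 6)],
    [(4, 0), (6, 1), (9, 2)],
    [⟨0, 1, 0, 2, 3, (14, [1, 3, 4, 5, 6]), none⟩,
      ⟨0, 2, 3, 5, 5, (19, [1, 0, 2, 5, 4]), none⟩]⟩,
  ⟨7, [(0, 1), (2, 3), (4, 5)], [(0, 2), (3, 6)],
    [(3, 1), (8, 3)],
    [⟨1, 2, 3, 7, 7, (18, [0, 1, 2, 7, 4, 5]), some (37, [1, 0, 4, 5, 2, 3, 7, 6])⟩]⟩,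
  ⟨7, [(0, 1), (2, 3), (4, 4), (5, 5)], [(0, 6), (5, 1), (5, 4)],
    [(4, 0), (9, 2)],
    [⟨0, 2, 3, 4, 4, (31, [4, 2, 1, 0, 5, 6]), none⟩]⟩,
  ⟨8, [(0, 1), (2, 3), (4, 5), (6, 6)], [(0, 2), (4, 6), (4, 7)],
    [(3, 0), (8, 2)],
    [⟨0, 1, 0, 4, 5, (38, [3, 2, 1, 5, 6, 0, 4, 7]), none⟩]⟩,
  ⟨8, [(0, 1), (2, 3), (4, 5), (6, 6)], [(1, 4), (5, 6), (5, 7)],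
    [(3, 0), (8, 2)],
    [⟨0, 0, 1, 5, 4, (38, [0, 4, 2, 3, 6, 1, 5, 7]), none⟩]⟩,
  ⟨8, [(0, 1), (2, 3), (4, 4)], [(1, 5), (6, 4), (6, 7)],
    [(2, 0), (7, 2)],
    [⟨0, 1, 0, 4, 4, (39, [4, 1, 2, 3, 6, 7, 5]), none⟩]⟩,
  ⟨7, [(0, 1), (2, 3)], [(4, 0), (4, 5), (1, 6)],
    [(1, 0), (6, 2)],
    [⟨0, 1, 0, 2, 3, (12, [3, 1, 6]), none⟩]⟩]

lemma strategyTable_ok : strategyTable.OK := by decide +kernel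

/-- Builder wins the `(P_4, P_n)` game within `⌈7n/5⌉ - 1` rounds. -/
lemma win_emptyCol {n : ℕ} (hn : 10 ≤ n) : Win n ((7 * n + 4) / 5 - 1) emptyCol := by
  have hspare : ∃ v, (strategyTable.node 0).spareAt (n - 1) = some v ∧
      v ≤ (7 * n + 4) / 5 - 1 - (n - 1) := by
    rw [Node.spareAt, if_neg (by omega)]
    have hlt : (n - 1 - 6) % 5 < 5 := Nat.mod_lt _ (by norm_num)
    have : ∀ r < 5, ∃ u, (strategyTable.node 0).spare.lookup (6 + r) = some u ∧
        5 * u ≤ 2 * (6 + r) + 6 := by decide +kernel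
    obtain ⟨u, hu, hle⟩ := this _ hlt
    exact ⟨_, by rw [hu]; rfl, by simp only; omega⟩
  obtain ⟨v, hv, hle⟩ := hspare
  refine Table.win strategyTable_ok (nd := strategyTable.node 0)
    (by simp [strategyTable, Table.node]) (φ := id) hv hle
    (by omega) ⟨Function.injective_id.injOn, by simp [strategyTable, Table.node], [[0]], ?_, ?_, ?_⟩
  · simp [strategyTable, Table.node, BlueFrom]
  · simp
  · simp [strategyTable, Table.node]
    omega

/-! ### From forced wins to strategies -/

lemma Win.mono {n M N : ℕ} (hMN : M ≤ N) {C : Coloring} (h : Win n M C) : Win n N C := by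
  induction hMN with
  | refl => exact h
  | step _ ih => exact ih.succ

lemma exists_fresh_edge {C : Coloring} (hC : {e | C e ≠ none}.Finite) :
    ∃ e : Sym2 ℕ, ¬e.IsDiag ∧ C e = none := by
  by_contra! h
  have hinj : Function.Injective fun i : ℕ => s(0, i + 1) := fun i j hij => by simpa using hij
  refine Set.infinite_range_of_injective hinj (hC.subset ?_)
  rintro _ ⟨i, rfl⟩
  exact h _ (by simp)

lemma exists_good_edge (n : ℕ) {C : Coloring} (hC : {e | C e ≠ none}.Finite) :
    ∃ e : Sym2 ℕ, ¬e.IsDiag ∧ C e = none ∧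
      (¬Ends 4 n C → ∀ N, Win n N C → ∀ c, Win n (N - 1) (Function.update C e (some c))) := by
  classical
  by_cases h : ¬Ends 4 n C ∧ ∃ N, Win n N C
  · obtain ⟨hE, hN⟩ := h
    have hmin := Nat.find_spec hN
    cases hM : Nat.find hN with
    | zero =>
      rw [hM] at hmin
      exact absurd hmin hE
    | succ M =>
      rw [hM] at hmin
      obtain ⟨e, h1, h2, h3⟩ := hmin.resolve_left hE
      refine ⟨e, h1, h2, fun _ N hW c => (h3 c).mono ?_⟩
      have := Nat.find_min' hN hW
      omega
  · obtain ⟨e, h1, h2⟩ := exists_fresh_edge hC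
    exact ⟨e, h1, h2, fun hE N hW => absurd ⟨hE, N, hW⟩ h⟩

lemma finite_colored_play (B : BuilderStrat) (P : PainterStrat) (t : ℕ) :
    {e | play emptyCol B P t e ≠ none}.Finite := by
  induction t with
  | zero => simp [play, emptyCol]
  | succ t ih =>
    refine (ih.insert (B (play emptyCol B P t))).subset fun e he => ?_
    by_cases h : e = B (play emptyCol B P t)
    · exact .inl h
    · exact .inr (by simpa [play, h] using he)

/-- A forced win from the empty position bounds the online size Ramsey number. -/
lemma Win.exists_strategy {n N : ℕ} (h : Win n N emptyCol) :
    ∃ B : BuilderStrat, BuilderOK emptyCol B ∧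
      ∀ P : PainterStrat, ∃ s ≤ N, Ends 4 n (play emptyCol B P s) := by
  choose! B h1 h2 h3 using fun C => exists_good_edge n (C := C)
  refine ⟨B, fun P t => ⟨h2 _ (finite_colored_play B P t), h1 _ (finite_colored_play B P t)⟩,
    fun P => ?_⟩
  by_contra! hE
  have key : ∀ t ≤ N, Win n (N - t) (play emptyCol B P t) := by
    intro t
    induction t with
    | zero => exact fun _ => h
    | succ t ih =>
      intro ht
      exact h3 _ (finite_colored_play B P t) (hE t (by omega)) _ (ih (by omega)) _
  have := key N le_rfl
  rw [Nat.sub_self] at this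
  exact hE N le_rfl this

/-! ### Painter's side -/

/-- Painter answers red unless this completes a red `P_4`. -/
noncomputable def greedyPainter : PainterStrat := fun C e =>
  open Classical in decide ¬HasPath (Function.update C e (some true)) true 4

lemma HasPath.mono {C C' : Coloring} {c : Bool} {k : ℕ}
    (hC : ∀ e, C e = some c → C' e = some c) (h : HasPath C c k) : HasPath C' c k := by
  obtain ⟨f, hf, h⟩ := h
  exact ⟨f, hf, fun i j hij => hC _ (h i j hij)⟩

/-- The properties of the positions that arise when Painter plays greedily. -/
structure GreedyPosition (C : Coloring) (F : Finset (Sym2 ℕ)) : Prop where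
  mem_iff : ∀ e, e ∈ F ↔ C e ≠ none
  not_isDiag : ∀ e ∈ F, ¬e.IsDiag
  no_red : ¬HasPath C true 4
  forced : ∀ e, C e = some false → HasPath (Function.update C e (some true)) true 4

lemma exists_greedyPosition {B : BuilderStrat} (hB : BuilderOK emptyCol B) (t : ℕ) :
    ∃ F : Finset (Sym2 ℕ), F.card = t ∧ GreedyPosition (play emptyCol B greedyPainter t) F := by
  classical
  induction t with
  | zero =>
    refine ⟨∅, rfl, by simp [play, emptyCol], by simp, ?_, by simp [play, emptyCol]⟩
    rintro ⟨f, -, h⟩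
    simp [play, emptyCol] at h
    exact h 0 1 rfl
  | succ t ih =>
    obtain ⟨F, hF, h⟩ := ih
    obtain ⟨hnone, hdiag⟩ := hB greedyPainter t
    rw [play]
    set C := play emptyCol B greedyPainter t
    set e := B C
    have he : e ∉ F := by simpa [h.mem_iff] using hnone
    refine ⟨insert e F, by rw [Finset.card_insert_of_notMem he, hF], ?_, ?_, ?_, ?_⟩
    · intro d
      by_cases hd : d = e
      · simp [hd]
      · simp [hd, h.mem_iff]
    · intro d hd
      rcases Finset.mem_insert.1 hd with rfl | hd
      · exact hdiag
      · exact h.not_isDiag d hd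
    · by_cases hP : HasPath (Function.update C e (some true)) true 4
      · refine fun hp => h.no_red (hp.mono fun d hd => ?_)
        by_cases hde : d = e
        · simp [hde, greedyPainter, hP] at hd
        · simpa [hde] using hd
      · simp [greedyPainter, hP]
    · intro d hd
      by_cases hde : d = e
      · subst hde
        have : HasPath (Function.update C (B C) (some true)) true 4 := by
          simpa [greedyPainter] using hd
        simpa using this
      · have := h.forced d (by simpa [hde] using hd)
        refine this.mono fun d' hd' => ?_
        by_cases hd'd : d' = d
        · simp [hd'd]
        · rw [Function.update_of_ne hd'd] at hd' ⊢
          rw [Function.update_of_ne, hd']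
          rintro rfl
          simp [hnone] at hd'

namespace GreedyPosition

variable {C : Coloring} {F : Finset (Sym2 ℕ)}

lemma ne_of_red (h : GreedyPosition C F) {u v : ℕ} (huv : C s(u, v) = some true) : u ≠ v := by
  have := h.not_isDiag s(u, v) ((h.mem_iff _).2 (by simp [huv]))
  simpa using this

lemma not_path (h : GreedyPosition C F) {a b c d : ℕ} (hab : C s(a, b) = some true)
    (hbc : C s(b, c) = some true) (hcd : C s(c, d) = some true) (hac : a ≠ c) (had : a ≠ d)
    (hbd : b ≠ d) : False := by
  have h1 := h.ne_of_red hab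
  have h2 := h.ne_of_red hbc
  have h3 := h.ne_of_red hcd
  exact h.no_red (hasPath_four (by simp [*]) hab hbc hcd)

/-- `v` is the end of a red path of length two. -/
def IsTip (C : Coloring) (v : ℕ) : Prop :=
  ∃ a b, b ≠ v ∧ C s(v, a) = some true ∧ C s(a, b) = some true

/-- `v` lies on a red edge. -/
def IsMet (C : Coloring) (v : ℕ) : Prop := ∃ a, C s(v, a) = some true

lemma IsTip.isMet {v : ℕ} (h : IsTip C v) : IsMet C v := by
  obtain ⟨a, -, -, h, -⟩ := h
  exact ⟨a, h⟩

lemma isTip_of_blue (h : GreedyPosition C F) {u v : ℕ} (huv : C s(u, v) = some false)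
    (hu : ¬IsMet C u) : IsTip C v := by
  obtain ⟨f, hf, hp⟩ := h.forced _ huv
  have hp0 := hp 0 1 rfl
  have hp1 := hp 1 2 rfl
  have hp2 := hp 2 3 rfl
  have h01 : f 0 ≠ f 1 := hf.ne (by decide)
  have h02 : f 0 ≠ f 2 := hf.ne (by decide)
  have h03 : f 0 ≠ f 3 := hf.ne (by decide)
  have h12 : f 1 ≠ f 2 := hf.ne (by decide)
  have h13 : f 1 ≠ f 3 := hf.ne (by decide)
  have h23 : f 2 ≠ f 3 := hf.ne (by decide)
  generalize f 0 = a at *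
  generalize f 1 = b at *
  generalize f 2 = c at *
  generalize f 3 = d at *
  have hu' : ∀ x, C s(u, x) ≠ some true := fun x hx => hu ⟨x, hx⟩
  have hu'' : ∀ x, C s(x, u) ≠ some true := fun x hx => hu ⟨x, by rwa [Sym2.eq_swap]⟩
  have upd : ∀ x y, Function.update C s(u, v) (some true) s(x, y) = some true →
      (x = u ∧ y = v) ∨ (x = v ∧ y = u) ∨ C s(x, y) = some true := by
    intro x y hxy
    by_cases hxy' : s(x, y) = s(u, v)
    · simpa [or_assoc] using Or.inl (b := C s(x, y) = some true) hxy'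
    · rw [Function.update_of_ne hxy'] at hxy
      exact .inr (.inr hxy)
  have sw : ∀ x y, C s(x, y) = some true → C s(y, x) = some true := fun x y hxy => by
    rwa [Sym2.eq_swap]
  rcases upd _ _ hp0 with ⟨rfl, rfl⟩ | ⟨rfl, rfl⟩ | h0
  · rcases upd _ _ hp1 with ⟨h, -⟩ | ⟨-, h⟩ | h1
    · exact absurd h.symm h01
    · exact absurd h.symm h02
    rcases upd _ _ hp2 with ⟨h, -⟩ | ⟨-, h⟩ | h2
    · exact absurd h.symm h02
    · exact absurd h.symm h03
    exact ⟨_, _, h13.symm, h1, h2⟩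
  · rcases upd _ _ hp1 with ⟨-, h⟩ | ⟨h, -⟩ | h1
    · exact absurd h.symm h02
    · exact absurd h.symm h01
    exact absurd h1 (hu' _)
  · rcases upd _ _ hp1 with ⟨rfl, rfl⟩ | ⟨rfl, rfl⟩ | h1
    · exact absurd h0 (hu'' _)
    · rcases upd _ _ hp2 with ⟨-, h⟩ | ⟨h, -⟩ | h2
      · exact absurd h.symm h13
      · exact absurd h.symm h12
      exact absurd h2 (hu' _)
    · rcases upd _ _ hp2 with ⟨rfl, rfl⟩ | ⟨rfl, rfl⟩ | h2
      · exact absurd h1 (hu'' _)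
      · exact ⟨_, _, h02, sw _ _ h1, sw _ _ h0⟩
      · exact (h.not_path h0 h1 h2 h02 h03 h13).elim

end GreedyPosition

namespace GreedyPosition

variable {C : Coloring} {F : Finset (Sym2 ℕ)}

/-- `v` lies on at least two red edges. -/
def IsInner (C : Coloring) (v : ℕ) : Prop :=
  ∃ a b, a ≠ b ∧ C s(v, a) = some true ∧ C s(v, b) = some true

open Classical in
/-- The red neighbours of `v`. -/
noncomputable def redNbrs (F : Finset (Sym2 ℕ)) (C : Coloring) (v : ℕ) : Finset ℕ :=
  (F.biUnion Sym2.toFinset).filter fun u => C s(v, u) = some true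

lemma mem_redNbrs (h : GreedyPosition C F) {v u : ℕ} :
    u ∈ redNbrs F C v ↔ C s(v, u) = some true := by
  simp only [redNbrs, Finset.mem_filter, Finset.mem_biUnion, Sym2.mem_toFinset,
    and_iff_right_iff_imp]
  exact fun huv => ⟨s(v, u), (h.mem_iff _).2 (by simp [huv]), by simp⟩

open Classical in
/-- The red edges. -/
noncomputable def reds (F : Finset (Sym2 ℕ)) (C : Coloring) : Finset (Sym2 ℕ) :=
  F.filter fun e => C e = some true

/-- If each red edge distributes the weight `2 * c` among its ends, the total weight received
by a set of vertices is at most `2 * c` times the number of red edges. -/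
lemma sum_le_of_discharge (h : GreedyPosition C F) {g : ℕ → ℕ → ℕ} {c : ℕ}
    (hg : ∀ u v, g u v + g v u = 2 * c) {S : Finset ℕ} {ω : ℕ → ℕ}
    (hω : ∀ v ∈ S, ω v ≤ ∑ u ∈ redNbrs F C v, g v u) :
    ∑ v ∈ S, ω v ≤ 2 * c * (reds F C).card := by
  classical
  set V := S ∪ F.biUnion Sym2.toFinset
  set P := (V ×ˢ V).filter fun p => C s(p.1, p.2) = some true
  have hV : ∀ v u, C s(v, u) = some true → u ∈ V := fun v u huv =>
    Finset.mem_union_right _ (Finset.mem_filter.1 (h.mem_redNbrs.2 huv)).1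
  have hP : ∑ v ∈ S, ω v ≤ ∑ p ∈ P, g p.1 p.2 := by
    rw [Finset.sum_filter, Finset.sum_product]
    refine (Finset.sum_le_sum hω).trans ((Finset.sum_le_sum_of_subset
      Finset.subset_union_left).trans (Finset.sum_le_sum fun v _ => ?_))
    rw [← Finset.sum_filter]
    refine Finset.sum_le_sum_of_subset fun u hu => ?_
    have := h.mem_redNbrs.1 hu
    exact Finset.mem_filter.2 ⟨hV v u this, this⟩
  have hswap : ∑ p ∈ P, g p.2 p.1 = ∑ p ∈ P, g p.1 p.2 := by
    refine Finset.sum_nbij' Prod.swap Prod.swap ?_ ?_ ?_ ?_ ?_ <;>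
      simp +contextual [P, Sym2.eq_swap]
  have hsum : ∑ p ∈ P, g p.1 p.2 + ∑ p ∈ P, g p.2 p.1 = P.card * (2 * c) := by
    rw [← Finset.sum_add_distrib, Finset.sum_congr rfl fun p _ => hg p.1 p.2]
    simp
  have hcard : P.card ≤ 2 * (reds F C).card := by
    refine (Finset.card_le_mul_card_image (f := fun p : ℕ × ℕ => s(p.1, p.2)) P 2 ?_).trans
      (Nat.mul_le_mul_left _ (Finset.card_le_card ?_))
    · rintro e -
      induction e with
      | _ u v =>
        refine (Finset.card_le_card (t := {(u, v), (v, u)}) fun p hp => ?_).trans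
          (Finset.card_insert_le _ _)
        have := (Finset.mem_filter.1 hp).2
        simpa [Prod.ext_iff] using this
    · intro e he
      obtain ⟨p, hp, rfl⟩ := Finset.mem_image.1 he
      have := (Finset.mem_filter.1 hp).2
      exact Finset.mem_filter.2 ⟨(h.mem_iff _).2 (by simp [this]), this⟩
  have : 2 * ∑ p ∈ P, g p.1 p.2 = P.card * (2 * c) := by omega
  have : P.card * (2 * c) ≤ 2 * (reds F C).card * (2 * c) := Nat.mul_le_mul_right _ hcard
  nlinarith

lemma le_sum_of_mem (h : GreedyPosition C F) {g : ℕ → ℕ → ℕ} {v a : ℕ}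
    (ha : C s(v, a) = some true) : g v a ≤ ∑ u ∈ redNbrs F C v, g v u :=
  Finset.single_le_sum (f := g v) (fun _ _ => Nat.zero_le _) (h.mem_redNbrs.2 ha)

lemma le_sum_of_mem₂ (h : GreedyPosition C F) {g : ℕ → ℕ → ℕ} {v a b : ℕ} (hab : a ≠ b)
    (ha : C s(v, a) = some true) (hb : C s(v, b) = some true) :
    g v a + g v b ≤ ∑ u ∈ redNbrs F C v, g v u := by
  rw [← Finset.sum_pair (f := g v) hab]
  refine Finset.sum_le_sum_of_subset fun u hu => ?_
  rcases Finset.mem_insert.1 hu with rfl | hu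
  · exact h.mem_redNbrs.2 ha
  · rw [Finset.mem_singleton.1 hu]
    exact h.mem_redNbrs.2 hb

/-- A tip is a red leaf attached to an inner vertex or it lies in a red triangle. -/
lemma tip_cases (h : GreedyPosition C F) {v : ℕ} (hv : IsTip C v) :
    (¬IsInner C v ∧ ∃ a, C s(v, a) = some true ∧ IsInner C a) ∨
      (IsInner C v ∧ ∃ a b, a ≠ b ∧ C s(v, a) = some true ∧ C s(v, b) = some true ∧
        IsInner C a ∧ IsInner C b) := by
  obtain ⟨a, b, hbv, hva, hab⟩ := hv
  have hav : C s(a, v) = some true := by rwa [Sym2.eq_swap]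
  have hba : C s(b, a) = some true := by rwa [Sym2.eq_swap]
  by_cases hI : IsInner C v
  · obtain ⟨c, hca, hvc⟩ : ∃ c, c ≠ a ∧ C s(v, c) = some true := by
      obtain ⟨c, d, hcd, hc, hd⟩ := hI
      by_cases hca : c = a
      · exact ⟨d, by rintro rfl; exact hcd hca, hd⟩
      · exact ⟨c, hca, hc⟩
    have hcv : C s(c, v) = some true := by rwa [Sym2.eq_swap]
    obtain rfl : c = b := by
      by_contra hcb
      exact h.not_path hcv hva hab hca hcb hbv.symm
    exact .inr ⟨hI, a, c, hca.symm, hva, hvc, ⟨v, c, hbv.symm, hav, hab⟩,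
      ⟨v, a, (h.ne_of_red hva), hcv, hba⟩⟩
  · exact .inl ⟨hI, a, hva, v, b, hbv.symm, hav, hab⟩

lemma card_tip_le (h : GreedyPosition C F) {A : Finset ℕ} (hA : ∀ v ∈ A, IsTip C v) :
    A.card ≤ (reds F C).card := by
  classical
  obtain ⟨g, hg⟩ : ∃ g : ℕ → ℕ → ℕ, ∀ v u, g v u =
      if IsInner C v then if IsInner C u then 1 else 0 else if IsInner C u then 2 else 1 :=
    ⟨_, fun _ _ => rfl⟩
  have := h.sum_le_of_discharge (c := 1) (S := A) (ω := fun _ => 2) (g := g)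
    (fun u v => by rw [hg, hg]; split_ifs <;> rfl) (fun v hv => by
      rcases h.tip_cases (hA v hv) with ⟨h1, a, h2, h3⟩ | ⟨h1, a, b, h2, h3, h4, h5, h6⟩
      · exact le_trans (by simp [hg, h1, h3]) (h.le_sum_of_mem h2)
      · exact le_trans (by simp [hg, h1, h5, h6]) (h.le_sum_of_mem₂ h2 h3 h4))
  simp at this
  omega

lemma card_tip_add_card_met_le (h : GreedyPosition C F) {A D : Finset ℕ} (hAD : A ⊆ D)
    (hA : ∀ v ∈ A, IsTip C v) (hD : ∀ v ∈ D, IsMet C v) :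
    2 * (A.card + D.card) ≤ 5 * (reds F C).card := by
  classical
  obtain ⟨g, hg⟩ : ∃ g : ℕ → ℕ → ℕ, ∀ v u, g v u =
      if IsInner C v then if IsInner C u then 5 else 2 else if IsInner C u then 8 else 5 :=
    ⟨_, fun _ _ => rfl⟩
  have := h.sum_le_of_discharge (c := 5) (S := D) (ω := fun v => 4 + if v ∈ A then 4 else 0)
    (g := g) (fun u v => by rw [hg, hg]; split_ifs <;> rfl) (fun v hv => by
      by_cases hvA : v ∈ A
      · rcases h.tip_cases (hA v hvA) with ⟨h1, a, h2, h3⟩ | ⟨h1, a, b, h2, h3, h4, h5, h6⟩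
        · exact le_trans (by simp [hg, h1, h3, hvA]) (h.le_sum_of_mem h2)
        · exact le_trans (by simp [hg, h1, h5, h6, hvA]) (h.le_sum_of_mem₂ h2 h3 h4)
      · by_cases hI : IsInner C v
        · obtain ⟨a, b, hab, ha, hb⟩ := id hI
          refine le_trans ?_ (h.le_sum_of_mem₂ hab ha hb)
          simp only [hg, hvA, hI, if_true, if_false]
          split_ifs <;> omega
        · obtain ⟨a, ha⟩ := hD v hv
          refine le_trans ?_ (h.le_sum_of_mem ha)
          simp only [hg, hvA, hI, if_false]
          split_ifs <;> omega)
  rw [Finset.sum_add_distrib, ← Finset.sum_filter, Finset.filter_mem_eq_inter,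
    Finset.inter_eq_right.2 hAD] at this
  simp at this
  omega

/-- Along a blue path on `n ≥ 5` vertices there are at least `2 * n / 5` red edges. -/
lemma two_mul_le_five_mul_card_reds (h : GreedyPosition C F) {n : ℕ} (hn : 5 ≤ n) {f : ℕ → ℕ}
    (hf : Set.InjOn f {i | i < n}) (hp : ∀ i, i + 1 < n → C s(f i, f (i + 1)) = some false) :
    2 * n ≤ 5 * (reds F C).card := by
  classical
  set I := (Finset.range n).filter fun i => ¬IsMet C (f i)
  set D := (Finset.range n).filter fun i => IsMet C (f i)
  set A := (Finset.range n).filter fun i => IsTip C (f i)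
  have hsucc : ∀ i ∈ I, i + 1 < n → i + 1 ∈ A := fun i hi hin =>
    Finset.mem_filter.2 ⟨Finset.mem_range.2 hin,
      h.isTip_of_blue (hp i hin) (Finset.mem_filter.1 hi).2⟩
  have hpred : ∀ i, i + 1 ∈ I → i ∈ A := fun i hi => by
    have hin := Finset.mem_range.1 (Finset.mem_filter.1 hi).1
    refine Finset.mem_filter.2 ⟨Finset.mem_range.2 (by omega),
      h.isTip_of_blue (u := f (i + 1)) ?_ (Finset.mem_filter.1 hi).2⟩
    rw [Sym2.eq_swap]
    exact hp i hin
  have hAD : A ⊆ D := fun i hi => by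
    rw [Finset.mem_filter] at hi ⊢
    exact ⟨hi.1, hi.2.isMet⟩
  have hdisj : ∀ i ∈ D, i ∉ I := fun i hi hi' =>
    (Finset.mem_filter.1 hi').2 (Finset.mem_filter.1 hi).2
  have hcard : D.card + I.card = n := by
    simpa using Finset.card_filter_add_card_filter_not (s := Finset.range n) fun i => IsMet C (f i)
  have hinj : ∀ s : Finset ℕ, s ⊆ D → (s.image f).card = s.card := fun s hs =>
    Finset.card_image_of_injOn (hf.mono fun i hi => by
      simpa using Finset.mem_range.1 (Finset.mem_filter.1 (hs hi)).1)
  have hA : ∀ v ∈ A.image f, IsTip C v := by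
    rintro _ hv
    obtain ⟨i, hi, rfl⟩ := Finset.mem_image.1 hv
    exact (Finset.mem_filter.1 hi).2
  have hD : ∀ v ∈ D.image f, IsMet C v := by
    rintro _ hv
    obtain ⟨i, hi, rfl⟩ := Finset.mem_image.1 hv
    exact (Finset.mem_filter.1 hi).2
  have h1 := h.card_tip_le hA
  have h2 := h.card_tip_add_card_met_le (Finset.image_subset_image hAD) hA hD
  rw [hinj _ hAD] at h1 h2
  rw [hinj _ subset_rfl] at h2
  by_cases hk : ∃ k ≤ n, (∀ j, j + 1 = k → j ∉ I) ∧ (k < n → k ∉ I)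
  · obtain ⟨k, hkn, hk1, hk2⟩ := hk
    have : I.card ≤ A.card := by
      refine Finset.card_le_card_of_injOn (fun i => if i < k then i + 1 else i - 1) ?_ ?_
      · intro i hi
        have hin := Finset.mem_range.1 (Finset.mem_filter.1 hi).1
        simp only
        split_ifs with hik
        · refine hsucc i hi ?_
          have : i + 1 ≠ k := fun hik' => hk1 i hik' hi
          omega
        · have : i ≠ k := by
            rintro rfl
            exact hk2 hin hi
          refine hpred (i - 1) ?_
          rwa [Nat.sub_add_cancel (by omega)]
      · intro i hi j hj hij
        have hi1 : i + 1 ≠ k := fun hik' => hk1 i hik' hi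
        have hj1 : j + 1 ≠ k := fun hik' => hk1 j hik' hj
        have hi2 : i ≠ k := by
          rintro rfl
          exact hk2 (Finset.mem_range.1 (Finset.mem_filter.1 hi).1) hi
        have hj2 : j ≠ k := by
          rintro rfl
          exact hk2 (Finset.mem_range.1 (Finset.mem_filter.1 hj).1) hj
        simp only at hij
        split_ifs at hij <;> omega
    omega
  · push Not at hk
    have hDA : D ⊆ A := fun i hi => by
      have hin := Finset.mem_range.1 (Finset.mem_filter.1 hi).1
      by_cases hi1 : i + 1 < n
      · refine hpred i (hk (i + 1) hin fun j hj => ?_).2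
        obtain rfl : j = i := by omega
        exact hdisj _ hi
      · have := (hk n le_rfl fun j hj => by
          obtain rfl : j = i := by omega
          exact hdisj _ hi).1
        omega
    have : I.card ≤ A.card + 1 := by
      have : (I.erase (n - 1)).card ≤ A.card := by
        refine Finset.card_le_card_of_injOn (· + 1) ?_ (by simp)
        intro i hi
        obtain ⟨hi1, hi2⟩ := Finset.mem_erase.1 hi
        have hin := Finset.mem_range.1 (Finset.mem_filter.1 hi2).1
        exact hsucc i hi2 (by omega)
      have := Finset.pred_card_le_card_erase (s := I) (a := n - 1)
      omega
    have := Finset.card_le_card hDA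
    omega

lemma card_add_card_reds_le (h : GreedyPosition C F) {n : ℕ} {f : ℕ → ℕ}
    (hf : Set.InjOn f {i | i < n}) (hp : ∀ i, i + 1 < n → C s(f i, f (i + 1)) = some false) :
    n - 1 + (reds F C).card ≤ F.card := by
  classical
  set S := (Finset.range (n - 1)).image fun i => s(f i, f (i + 1))
  have hblue : ∀ e ∈ S, C e = some false := by
    intro e he
    obtain ⟨i, hi, rfl⟩ := Finset.mem_image.1 he
    exact hp i (by have := Finset.mem_range.1 hi; omega)
  have hS : S.card = n - 1 := by
    rw [Finset.card_image_of_injOn, Finset.card_range]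
    intro i hi j hj hij
    simp only [Finset.coe_range, Set.mem_Iio] at hi hj
    have hinj : ∀ a b, a < n → b < n → f a = f b → a = b := fun a b ha hb hab => hf ha hb hab
    rcases Sym2.eq_iff.1 hij with ⟨h1, -⟩ | ⟨h1, h2⟩
    · exact hinj _ _ (by omega) (by omega) h1
    · have := hinj _ _ (by omega) (by omega) h1
      have := hinj _ _ (by omega) (by omega) h2
      omega
  rw [← hS, ← Finset.card_union_of_disjoint]
  · refine Finset.card_le_card (Finset.union_subset (fun e he => ?_) (Finset.filter_subset _ _))
    exact (h.mem_iff e).2 (by simp [hblue e he])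
  · refine Finset.disjoint_left.2 fun e he he' => ?_
    have := (Finset.mem_filter.1 he').2
    simp [hblue e he] at this

end GreedyPosition

lemma HasPath.exists_nat {C : Coloring} {c : Bool} {n : ℕ} (h : HasPath C c n) :
    ∃ f : ℕ → ℕ, Set.InjOn f {i | i < n} ∧ ∀ i, i + 1 < n → C s(f i, f (i + 1)) = some c := by
  obtain ⟨f, hf, h⟩ := h
  refine ⟨fun i => if hi : i < n then f ⟨i, hi⟩ else 0, fun i hi j hj hij => ?_, fun i hi => ?_⟩
  · simp only [Set.mem_ofPred_eq] at hi hj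
    simp only [hi, hj, dif_pos] at hij
    simpa using hf hij
  · simp only [hi, Nat.lt_of_succ_lt hi, dif_pos]
    exact h _ _ rfl

/-- Greedy play of Painter lasts for at least `⌈7n/5⌉ - 1` rounds. -/
lemma le_of_ends_greedy {B : BuilderStrat} (hB : BuilderOK emptyCol B) {n s : ℕ} (hn : 5 ≤ n)
    (h : Ends 4 n (play emptyCol B greedyPainter s)) : (7 * n + 4) / 5 - 1 ≤ s := by
  obtain ⟨F, rfl, hG⟩ := exists_greedyPosition hB s
  obtain ⟨f, hf, hp⟩ := (h.resolve_left hG.no_red).exists_nat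
  have h1 := hG.two_mul_le_five_mul_card_reds hn hf hp
  have h2 := hG.card_add_card_reds_le hf hp
  omega

end OSR

/-- For every `n ≥ 10`, `r̃(P_4, P_n) = ⌈7n/5⌉ − 1`. -/
theorem OSR.onlineRamseyPath_four_eq (n : ℕ) (hn : 10 ≤ n) :
    (OSR.onlineRamseyPath 4 n : ℤ) = ⌈(7 * n : ℚ) / 5⌉ - 1 := by
  have hmem := (win_emptyCol hn).exists_strategy
  have heq : onlineRamseyPath 4 n = (7 * n + 4) / 5 - 1 := by
    refine le_antisymm (Nat.sInf_le hmem) (le_csInf ⟨_, hmem⟩ ?_)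
    rintro t ⟨B, hB, h⟩
    obtain ⟨s, hs, hE⟩ := h greedyPainter
    exact (le_of_ends_greedy hB (by omega) hE).trans hs
  have hceil : ⌈(7 * n : ℚ) / 5⌉ = ((7 * n + 4) / 5 : ℕ) := by
    obtain ⟨m, hm⟩ : ∃ m, m = (7 * n + 4) / 5 := ⟨_, rfl⟩
    have h1 : (7 * n : ℚ) ≤ 5 * m := by exact_mod_cast (by omega : 7 * n ≤ 5 * m)
    have h2 : (5 * m : ℚ) < 7 * n + 5 := by exact_mod_cast (by omega : 5 * m < 7 * n + 5)
    rw [← hm, Int.ceil_eq_iff, Int.cast_natCast]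
    constructor <;> linarith
  rw [heq, hceil]
  omega
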